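/- arXiv:2510.06159 — 2 statements merged into one kernel-verified Lean document; each statement's English description precedes it below -/
import Mathlib

section
/- In R_{3,7} = F_2[x,y]/(x^3 − 1, y^7 − 1), let c = 1 + y^3 + x y^2 + x y^4 and let H ∈ F_2^{21×42} be the binary check matrix of the self-dual bivariate-bicycle code BB(c, c^T), whose row indexed by a monomial α is the coefficient vector of (αc, αc^T) ∈ R_{3,7} ⊕ R_{3,7}. Then rank_{F_2}(H) = 18, so the code encodes k = 42 − 2·18 = 6 logical qubits, and the code distance equals 6: the minimum Hamming weight of a vector v ∈ F_2^{42} with H v = 0 that is not in the row space of H is 6. That is, BB(c, c^T; R_{3,7}) is a [[42, 6, 6]] code. -/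
open Matrix

/-- The check matrix of the self-dual bivariate-bicycle code `BB(c, cᵀ)` over
`R_{l,m} = F₂[x,y]/(xˡ-1, yᵐ-1) ≅ F₂^{ZMod l × ZMod m}`: the row indexed by the
monomial `α` is the coefficient vector of `(αc, αcᵀ)`. -/
def bbMat (l m : ℕ) (c : ZMod l × ZMod m → ZMod 2) :
    Matrix (ZMod l × ZMod m) ((ZMod l × ZMod m) ⊕ (ZMod l × ZMod m)) (ZMod 2) :=
  Matrix.of fun α => Sum.elim (fun β => c (β - α)) (fun β => c (α - β))

/-- Coefficient vector of `c = 1 + y³ + x y² + x y⁴ ∈ R_{3,7}`. -/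
def c42 : ZMod 3 × ZMod 7 → ZMod 2 := fun p =>
  if p = (0, 0) ∨ p = (0, 3) ∨ p = (1, 2) ∨ p = (1, 4) then 1 else 0

namespace BB42

abbrev I := ZMod 3 × ZMod 7
abbrev J := I ⊕ I

def idx (i : I) : ℕ := 7 * i.1.val + i.2.val

def colTab : List ℕ := [655377, 1310754, 540740, 1081353, 81938, 163876, 327752, 2216, 4432, 8737, 1218, 2309, 4618, 9236, 283648, 567296, 1118336, 155904, 295552, 591104, 1182208, 2569, 5138, 10276, 4296, 8465, 674, 1348, 328832, 657664, 1315328, 549888, 1083520, 86272, 172544, 147476, 294952, 589904, 1179681, 278594, 557061, 1114122]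

def colN : J → ℕ
  | Sum.inl b => colTab.getD (idx b) 0
  | Sum.inr b => colTab.getD (21 + idx b) 0

def rowTab : List (List ℕ) := [
  [655377, 1081353, 8737, 2309, 2569, 8465, 1179681, 557061],
  [1310754, 81938, 1218, 4618, 5138, 674, 278594, 1114122],
  [540740, 163876, 2309, 9236, 10276, 1348, 147476, 557061],
  [1081353, 327752, 2216, 4618, 2569, 4296, 294952, 1114122],
  [655377, 81938, 4432, 9236, 5138, 8465, 147476, 589904],
  [1310754, 163876, 2216, 8737, 10276, 674, 294952, 1179681],
  [540740, 327752, 4432, 1218, 4296, 1348, 589904, 278594],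
  [2216, 1218, 1118336, 295552, 4296, 674, 328832, 1083520],
  [4432, 2309, 155904, 591104, 8465, 1348, 657664, 86272],
  [8737, 4618, 295552, 1182208, 2569, 674, 1315328, 172544],
  [1218, 9236, 283648, 591104, 5138, 1348, 328832, 549888],
  [2216, 2309, 567296, 1182208, 2569, 10276, 657664, 1083520],
  [4432, 4618, 283648, 1118336, 5138, 4296, 1315328, 86272],
  [8737, 9236, 567296, 155904, 10276, 8465, 549888, 172544],
  [540740, 81938, 283648, 155904, 549888, 86272, 147476, 278594],
  [1081353, 163876, 567296, 295552, 1083520, 172544, 294952, 557061],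
  [81938, 327752, 1118336, 591104, 328832, 86272, 589904, 1114122],
  [655377, 163876, 155904, 1182208, 657664, 172544, 147476, 1179681],
  [1310754, 327752, 283648, 295552, 328832, 1315328, 294952, 278594],
  [655377, 540740, 567296, 591104, 657664, 549888, 589904, 557061],
  [1310754, 1081353, 1118336, 1182208, 1315328, 1083520, 1179681, 1114122]]

def used (c : ℕ) : List ℕ → Bool
  | [] => false
  | a :: l => Nat.beq a c || used c l

def search : ℕ → ℕ → List ℕ → Bool
  | 0, s, _ => !(Nat.beq s 0)
  | n + 1, s, l => s.testBit s.log2 &&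
      (rowTab.getD s.log2 []).all fun c => used c l || search n (Nat.xor s c) (c :: l)

lemma used_iff (c : ℕ) (l : List ℕ) : used c l = true ↔ c ∈ l := by
  induction l with
  | nil => simp [used]
  | cons a l ih => rw [used, Bool.or_eq_true, ih, Nat.beq_eq, List.mem_cons, @eq_comm _ c a]

def bit (s k : ℕ) : ZMod 2 := if s.testBit k then 1 else 0

lemma bit_xor (s t k : ℕ) : bit (s ^^^ t) k = bit s k + bit t k := by
  unfold bit
  rw [Nat.testBit_xor]
  cases s.testBit k <;> cases t.testBit k <;> decide

def chk (a b : ZMod 2) : Bool := decide (a = b)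

lemma chk_iff (a b : ZMod 2) : chk a b = true ↔ a = b := by
  simp [chk]

lemma col_spec : ∀ j : J, ∀ i : I, bbMat 3 7 c42 i j = bit (colN j) (idx i) := by
  decide +kernel

lemma row_spec : ∀ i : I, ∀ j : J, bbMat 3 7 c42 i j ≠ 0 →
    colN j ∈ rowTab.getD (idx i) [] := by
  have h : ∀ i : I, ∀ j : J, (chk (bbMat 3 7 c42 i j) 0 ||
    used (colN j) (rowTab.getD (idx i) [])) = true := by decide +kernel
  intro i j hij
  have h1 := h i j
  rw [Bool.or_eq_true, used_iff, chk_iff] at h1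
  exact h1.resolve_left hij

lemma idx_spec : ∀ k : Fin 21, ∃ i : I, idx i = k := by
  decide +kernel

lemma rowTab_ge (k : ℕ) (hk : 21 ≤ k) : rowTab.getD k [] = [] := by
  apply List.getD_eq_default
  exact hk

lemma col_lt : ∀ j : J, colN j < 2 ^ 21 := by
  decide +kernel

lemma col_inj : ∀ j j' : J, colN j = colN j' → j = j' := by
  decide +kernel

lemma search_inl : search 4 (colN (Sum.inl 0)) [colN (Sum.inl 0)] = true := by
  decide +kernel

lemma search_inr : search 4 (colN (Sum.inr 0)) [colN (Sum.inr 0)] = true := by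
  decide +kernel

/-- translation of the index set -/
def sh (t : I) : J ≃ J := Equiv.sumCongr (Equiv.addRight t) (Equiv.addRight t)

lemma bb_sh (t i : I) (j : J) : bbMat 3 7 c42 (i + t) (sh t j) = bbMat 3 7 c42 i j := by
  rcases j with b | b <;> simp [bbMat, sh]

lemma ker_sh (t : I) (v : J → ZMod 2) (hv : (bbMat 3 7 c42).mulVec v = 0) :
    (bbMat 3 7 c42).mulVec (v ∘ sh t) = 0 := by
  ext i
  refine Eq.trans ?_ (congrFun hv (i + t))
  simp only [Matrix.mulVec, dotProduct]
  refine Fintype.sum_equiv (sh t) _ _ fun j => ?_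
  rw [bb_sh]; rfl

lemma norm_sh (t : I) (v : J → ZMod 2) : hammingNorm (v ∘ sh t) = hammingNorm v := by
  unfold hammingNorm
  refine Finset.card_equiv (sh t) fun j => ?_
  simp

lemma used_step (v : J → ZMod 2) (j : J) (hj : v j ≠ 0) (l : List ℕ)
    (hl : ∀ j, colN j ∈ l → v j = 0) :
    ∀ j', colN j' ∈ colN j :: l → (v + Pi.single j 1 : J → ZMod 2) j' = 0 := by
  intro j' hj'
  by_cases h : j' = j
  · subst h
    rw [Pi.add_apply, Pi.single_eq_same]
    revert hj; generalize v j' = a; revert a; decide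
  · rw [Pi.add_apply, Pi.single_eq_of_ne h, add_zero]
    rcases List.mem_cons.1 hj' with h' | h'
    · exact absurd (col_inj _ _ h') h
    · exact hl _ h'

/-- removing a support element -/
lemma remove (v : J → ZMod 2) (j : J) (hj : v j ≠ 0) :
    hammingNorm (v + Pi.single j 1) + 1 = hammingNorm v ∧
    ∀ i, (bbMat 3 7 c42).mulVec (v + Pi.single j 1) i
      = (bbMat 3 7 c42).mulVec v i + bit (colN j) (idx i) := by
  constructor
  · have h1 : v j = 1 := by
      revert hj; generalize v j = a; revert a; decide
    unfold hammingNorm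
    have : (Finset.univ.filter fun i => (v + Pi.single j 1 : J → ZMod 2) i ≠ 0)
        = (Finset.univ.filter fun i => v i ≠ 0).erase j := by
      ext i
      simp only [Finset.mem_filter, Finset.mem_univ, true_and, Finset.mem_erase, Pi.add_apply]
      by_cases h : i = j
      · subst h
        simp [h1]
        decide
      · simp [h]
    rw [this]
    exact Finset.card_erase_add_one (by simp [hj])
  · intro i
    rw [Matrix.mulVec_add, Pi.add_apply, Matrix.mulVec_single_one, ← col_spec]
    rfl

lemma search_sound : ∀ (n s : ℕ) (l : List ℕ) (v : J → ZMod 2), s < 2 ^ 21 →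
    search n s l = true → (∀ j, colN j ∈ l → v j = 0) →
    (∀ i, (bbMat 3 7 c42).mulVec v i = bit s (idx i)) → n < hammingNorm v := by
  intro n
  induction n with
  | zero =>
    intro s l v hs h hl hv
    rw [Nat.pos_iff_ne_zero, Ne, hammingNorm_eq_zero]
    rintro rfl
    simp only [search, Bool.not_eq_true'] at h
    have h0 : s ≠ 0 := by
      rintro rfl
      simp at h
    apply h0
    apply Nat.eq_of_testBit_eq
    intro k
    rw [Nat.zero_testBit]
    by_cases hk : k < 21
    · obtain ⟨i, hi⟩ := idx_spec ⟨k, hk⟩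
      have := hv i
      rw [Matrix.mulVec_zero, hi] at this
      simp only [bit, Pi.zero_apply] at this
      by_contra hc
      simp [hc] at this
    · exact Nat.testBit_lt_two_pow (lt_of_lt_of_le hs (Nat.pow_le_pow_right (by norm_num) (by omega)))
  | succ n ih =>
    intro s l v hs h hl hv
    simp only [search, Bool.and_eq_true, List.all_eq_true] at h
    obtain ⟨hb, hall⟩ := h
    have hk : s.log2 < 21 := by
      by_contra hc
      rw [Nat.testBit_lt_two_pow (lt_of_lt_of_le hs (Nat.pow_le_pow_right (by norm_num) (by omega)))] at hb
      exact absurd hb (by decide)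
    obtain ⟨i, hi⟩ := idx_spec ⟨s.log2, hk⟩
    have hi' : idx i = s.log2 := hi
    have h1 := hv i
    have : ∃ j, bbMat 3 7 c42 i j ≠ 0 ∧ v j ≠ 0 := by
      by_contra hc
      push Not at hc
      have h0 : (bbMat 3 7 c42).mulVec v i = 0 := by
        rw [Matrix.mulVec, dotProduct]
        apply Finset.sum_eq_zero
        intro j _
        by_cases hz : bbMat 3 7 c42 i j = 0
        · rw [hz, zero_mul]
        · rw [hc j hz, mul_zero]
      rw [h0, hi', bit, hb] at h1
      exact absurd h1 (by decide)
    obtain ⟨j, hj, hvj⟩ := this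
    obtain ⟨hw, hm⟩ := remove v j hvj
    have hmem := row_spec i j hj
    rw [hi'] at hmem
    have hnu : colN j ∉ l := fun hc => hvj (hl j hc)
    have hs' := hall _ hmem
    rw [Bool.or_eq_true, used_iff] at hs'
    have := ih (s ^^^ colN j) (colN j :: l) (v + Pi.single j 1)
      (Nat.xor_lt_two_pow hs (col_lt j)) (hs'.resolve_left hnu) (used_step v j hvj l hl)
      (fun i => by rw [hm, hv, bit_xor])
    omega

lemma min_dist_at (j : J) (hs : search 4 (colN j) [colN j] = true) (v : J → ZMod 2)
    (hv : (bbMat 3 7 c42).mulVec v = 0) (hj : v j ≠ 0) : 6 ≤ hammingNorm v := by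
  obtain ⟨hw, hm⟩ := remove v j hj
  have := search_sound 4 (colN j) [colN j] (v + Pi.single j 1) (col_lt j) hs
    (used_step v j hj [] (by simp))
    (fun i => by rw [hm, hv]; simp)
  omega

lemma min_dist (v : J → ZMod 2) (hv : (bbMat 3 7 c42).mulVec v = 0) (h0 : v ≠ 0) :
    6 ≤ hammingNorm v := by
  obtain ⟨j, hj⟩ := Function.ne_iff.1 h0
  rcases j with t | t
  · rw [← norm_sh t v]
    exact min_dist_at (Sum.inl 0) search_inl _ (ker_sh t v hv) (by simpa [sh] using hj)
  · rw [← norm_sh t v]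
    exact min_dist_at (Sum.inr 0) search_inr _ (ker_sh t v hv) (by simpa [sh] using hj)

def pivTab : List J := [Sum.inl (0,0), Sum.inl (0,1), Sum.inl (0,2), Sum.inl (0,3), Sum.inl (0,4), Sum.inl (0,5), Sum.inl (1,0), Sum.inl (1,1), Sum.inl (1,2), Sum.inl (1,3), Sum.inl (1,4), Sum.inl (1,5), Sum.inl (2,0), Sum.inl (2,1), Sum.inl (2,2), Sum.inr (0,0), Sum.inr (0,1), Sum.inr (0,2)]

def piv (k : Fin 18) : J := pivTab.getD k (Sum.inl (0, 0))

def bTab : List ℕ := [17455, 52238, 331837, 1019965, 105523, 148527, 1033107, 675618, 20902, 1007392, 675362, 366641, 314382, 873490, 39987, 379799, 759598, 858676]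

def B : Matrix (Fin 18) I (ZMod 2) := Matrix.of fun k i => bit (bTab.getD k 0) (idx i)

lemma BA : B * (bbMat 3 7 c42).submatrix id piv = 1 := by
  have h : ∀ i j : Fin 18, chk ((B * (bbMat 3 7 c42).submatrix id piv) i j)
    ((1 : Matrix (Fin 18) (Fin 18) (ZMod 2)) i j) = true := by decide +kernel
  ext i j
  exact (chk_iff _ _).1 (h i j)

def cTab : List ℕ := [8909357121, 26660962370, 618677403716, 1003077369928, 605205823568, 335864660064, 1847893565568, 3512580579584, 3659145159168, 3306371032064, 3521807394816, 2869660495872, 645941313536, 1867221204992, 2950526992384, 1973925445632, 3947850891264, 3185984929792]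

def C : Matrix (Fin 18) J (ZMod 2) := Matrix.of fun k => Sum.elim
  (fun b => bit (cTab.getD k 0) (idx b)) (fun b => bit (cTab.getD k 0) (21 + idx b))

lemma ABH : (bbMat 3 7 c42).submatrix id piv * C = bbMat 3 7 c42 := by
  have h : ∀ (i : I) (j : J), chk (((bbMat 3 7 c42).submatrix id piv * C) i j)
    (bbMat 3 7 c42 i j) = true := by decide +kernel
  ext i j
  exact (chk_iff _ _).1 (h i j)

lemma sub_eq {m n k : Type*} [Fintype n] [DecidableEq n]
    (H : Matrix m n (ZMod 2)) (f : k → n) :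
    H.submatrix id f = H * (1 : Matrix n n (ZMod 2)).submatrix id f := by
  ext i j
  simp [Matrix.mul_apply, Matrix.one_apply]

lemma rank_aux {m n : Type*} [Fintype m] [Fintype n] [DecidableEq n]
    (H : Matrix m n (ZMod 2)) (f : Fin 18 → n)
    (B : Matrix (Fin 18) m (ZMod 2)) (C : Matrix (Fin 18) n (ZMod 2))
    (h1 : B * H.submatrix id f = 1) (h2 : H.submatrix id f * C = H) : H.rank = 18 := by
  apply le_antisymm
  · calc H.rank = (H.submatrix id f * C).rank := by rw [h2]
      _ ≤ (H.submatrix id f).rank := Matrix.rank_mul_le_left _ _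
      _ ≤ 18 := by simpa using Matrix.rank_le_card_width (H.submatrix id f)
  · calc 18 = (1 : Matrix (Fin 18) (Fin 18) (ZMod 2)).rank := by rw [Matrix.rank_one]; rfl
      _ = (B * H.submatrix id f).rank := by rw [h1]
      _ ≤ (H.submatrix id f).rank := Matrix.rank_mul_le_right _ _
      _ = (H * (1 : Matrix n n (ZMod 2)).submatrix id f).rank := by rw [← sub_eq]
      _ ≤ H.rank := Matrix.rank_mul_le_left _ _

lemma rank_eq : (bbMat 3 7 c42).rank = 18 := rank_aux _ piv B C BA ABH

def wit : J → ZMod 2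
  | Sum.inl b => bit 873988098 (idx b)
  | Sum.inr b => bit 873988098 (21 + idx b)

def dual : J → ZMod 2
  | Sum.inl b => bit 127 (idx b)
  | Sum.inr b => bit 127 (21 + idx b)

lemma wit_ker : (bbMat 3 7 c42).mulVec wit = 0 := by
  ext i; revert i; decide +kernel

lemma dual_ker : (bbMat 3 7 c42).mulVec dual = 0 := by
  ext i; revert i; decide +kernel

lemma wit_dual : wit ⬝ᵥ dual = 1 := by decide +kernel

lemma wit_norm : hammingNorm wit = 6 := by decide +kernel

lemma wit_not : ¬ ∃ u, Matrix.vecMul u (bbMat 3 7 c42) = wit := by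
  rintro ⟨u, hu⟩
  have h := wit_dual
  rw [← hu, ← Matrix.dotProduct_mulVec, dual_ker, dotProduct_zero] at h
  exact absurd h (by decide)

end BB42

/-- **`BB(1 + y³ + x y² + x y⁴, ·ᵀ; R_{3,7})` is a `[[42, 6, 6]]` code.**
The check matrix `H ∈ F₂^{21×42}` has rank 18 (so the code encodes
`k = 42 - 2·18 = 6` logical qubits), and the minimum Hamming weight of a vector
`v ∈ F₂^{42}` with `H v = 0` not in the row space of `H` equals 6. -/
theorem stmt_12 :
    (bbMat 3 7 c42).rank = 18 ∧
    sInf {w | ∃ v : ((ZMod 3 × ZMod 7) ⊕ (ZMod 3 × ZMod 7)) → ZMod 2,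
        (bbMat 3 7 c42).mulVec v = 0 ∧
        (¬ ∃ u, Matrix.vecMul u (bbMat 3 7 c42) = v) ∧ hammingNorm v = w} = 6 := by
  refine ⟨BB42.rank_eq, ?_⟩
  apply le_antisymm
  · exact Nat.sInf_le ⟨BB42.wit, BB42.wit_ker, BB42.wit_not, BB42.wit_norm⟩
  · refine le_csInf ⟨6, BB42.wit, BB42.wit_ker, BB42.wit_not, BB42.wit_norm⟩ ?_
    rintro w ⟨v, hv, hn, rfl⟩
    refine BB42.min_dist v hv ?_
    rintro rfl
    exact hn ⟨0, Matrix.zero_vecMul _⟩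
end

section
/- In R_{3,11} = F_2[x,y]/(x^3 − 1, y^{11} − 1), let c = 1 + y^3 + x y^2 + x y^4 and let H ∈ F_2^{33×66} be the binary check matrix of the self-dual bivariate-bicycle code BB(c, c^T), whose row indexed by a monomial α is the coefficient vector of (αc, αc^T) ∈ R_{3,11} ⊕ R_{3,11}. Then rank_{F_2}(H) = 30, so the code encodes k = 66 − 2·30 = 6 logical qubits, and the code distance equals 8: the minimum Hamming weight of a vector v ∈ F_2^{66} with H v = 0 that is not in the row space of H is 8. That is, BB(c, c^T; R_{3,11}) is a [[66, 6, 8]] code. -/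
open Matrix

/-- Coefficient vector of `c = 1 + y³ + x y² + x y⁴ ∈ R_{3,11}`. -/
def c66 : ZMod 3 × ZMod 11 → ZMod 2 := fun p =>
  if p = (0, 0) ∨ p = (0, 3) ∨ p = (1, 2) ∨ p = (1, 4) then 1 else 0

def tbl : List (ℕ × List (ℕ × ℕ)) := [
  (1, [(1, 2684354817), (8, 4303355913), (8192, 2105857), (32768, 36869), (8589934592, 40969), (2199023255552, 2101505), (4611686018427387904, 4831838721), (18446744073709551616, 2155872261)]),
  (2, [(2, 5368709634), (16, 20971538), (16384, 19458), (65536, 73738), (17179869184, 81938), (4398046511104, 10754), (9223372036854775808, 1077937154), (36893488147419103232, 4311744522)]),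
  (4, [(4, 2151678980), (32, 41943076), (32768, 36869), (131072, 147476), (34359738368, 163876), (8796093022208, 21508), (36028797018963968, 37748756), (18446744073709551616, 2155872261)]),
  (8, [(8, 4303355913), (64, 83886152), (65536, 73738), (262144, 294952), (8589934592, 40969), (68719476736, 327752), (72057594037927936, 75497512), (36893488147419103232, 4311744522)]),
  (16, [(16, 20971538), (128, 167772304), (131072, 147476), (524288, 589904), (17179869184, 81938), (137438953472, 655504), (36028797018963968, 37748756), (144115188075855872, 150995024)]),
  (32, [(32, 41943076), (256, 335544608), (262144, 294952), (1048576, 1179808), (34359738368, 163876), (274877906944, 1311008), (72057594037927936, 75497512), (288230376151711744, 301990048)]),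
  (64, [(64, 83886152), (512, 671089216), (524288, 589904), (2097152, 2359616), (68719476736, 327752), (549755813888, 2622016), (144115188075855872, 150995024), (576460752303423488, 603980096)]),
  (128, [(128, 167772304), (1024, 1342178432), (2048, 526976), (1048576, 1179808), (137438953472, 655504), (1099511627776, 1051776), (288230376151711744, 301990048), (1152921504606846976, 1207960192)]),
  (256, [(1, 2684354817), (256, 335544608), (4096, 1053952), (2097152, 2359616), (274877906944, 1311008), (2199023255552, 2101505), (576460752303423488, 603980096), (2305843009213693952, 2415920384)]),
  (512, [(2, 5368709634), (512, 671089216), (2048, 526976), (8192, 2105857), (549755813888, 2622016), (4398046511104, 10754), (1152921504606846976, 1207960192), (4611686018427387904, 4831838721)]),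
  (1024, [(4, 2151678980), (1024, 1342178432), (4096, 1053952), (16384, 19458), (1099511627776, 1051776), (8796093022208, 21508), (2305843009213693952, 2415920384), (9223372036854775808, 1077937154)]),
  (2048, [(2048, 526976), (16384, 19458), (16777216, 4312795136), (67108864, 75507712), (1099511627776, 1051776), (4398046511104, 10754), (17592186044416, 83904512), (4503599627370496, 4303882240)]),
  (4096, [(4096, 1053952), (32768, 36869), (33554432, 39849984), (134217728, 151015424), (2199023255552, 2101505), (8796093022208, 21508), (35184372088832, 167809024), (9007199254740992, 22024192)]),
  (8192, [(8192, 2105857), (65536, 73738), (67108864, 75507712), (268435456, 302030848), (8589934592, 40969), (4398046511104, 10754), (70368744177664, 335618048), (18014398509481984, 44048384)]),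
  (16384, [(16384, 19458), (131072, 147476), (134217728, 151015424), (536870912, 604061696), (17179869184, 81938), (8796093022208, 21508), (17592186044416, 83904512), (140737488355328, 671236096)]),
  (32768, [(32768, 36869), (262144, 294952), (268435456, 302030848), (1073741824, 1208123392), (8589934592, 40969), (34359738368, 163876), (35184372088832, 167809024), (281474976710656, 1342472192)]),
  (65536, [(65536, 73738), (524288, 589904), (536870912, 604061696), (2147483648, 2416246784), (17179869184, 81938), (68719476736, 327752), (70368744177664, 335618048), (562949953421312, 2684944384)]),
  (131072, [(131072, 147476), (1048576, 1179808), (1073741824, 1208123392), (4294967296, 4832493568), (34359738368, 163876), (137438953472, 655504), (140737488355328, 671236096), (1125899906842624, 5369888768)]),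
  (262144, [(262144, 294952), (2097152, 2359616), (4194304, 1079246848), (2147483648, 2416246784), (68719476736, 327752), (274877906944, 1311008), (281474976710656, 1342472192), (2251799813685248, 2154037248)]),
  (524288, [(2048, 526976), (524288, 589904), (8388608, 2158493696), (4294967296, 4832493568), (137438953472, 655504), (549755813888, 2622016), (562949953421312, 2684944384), (4503599627370496, 4303882240)]),
  (1048576, [(4096, 1053952), (1048576, 1179808), (4194304, 1079246848), (16777216, 4312795136), (274877906944, 1311008), (1099511627776, 1051776), (1125899906842624, 5369888768), (9007199254740992, 22024192)]),
  (2097152, [(8192, 2105857), (2097152, 2359616), (8388608, 2158493696), (33554432, 39849984), (549755813888, 2622016), (2199023255552, 2101505), (2251799813685248, 2154037248), (18014398509481984, 44048384)]),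
  (4194304, [(4, 2151678980), (16, 20971538), (4194304, 1079246848), (33554432, 39849984), (2251799813685248, 2154037248), (9007199254740992, 22024192), (36028797018963968, 37748756), (9223372036854775808, 1077937154)]),
  (8388608, [(8, 4303355913), (32, 41943076), (8388608, 2158493696), (67108864, 75507712), (4503599627370496, 4303882240), (18014398509481984, 44048384), (72057594037927936, 75497512), (18446744073709551616, 2155872261)]),
  (16777216, [(16, 20971538), (64, 83886152), (16777216, 4312795136), (134217728, 151015424), (17592186044416, 83904512), (9007199254740992, 22024192), (144115188075855872, 150995024), (36893488147419103232, 4311744522)]),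
  (33554432, [(32, 41943076), (128, 167772304), (33554432, 39849984), (268435456, 302030848), (35184372088832, 167809024), (18014398509481984, 44048384), (36028797018963968, 37748756), (288230376151711744, 301990048)]),
  (67108864, [(64, 83886152), (256, 335544608), (67108864, 75507712), (536870912, 604061696), (17592186044416, 83904512), (70368744177664, 335618048), (72057594037927936, 75497512), (576460752303423488, 603980096)]),
  (134217728, [(128, 167772304), (512, 671089216), (134217728, 151015424), (1073741824, 1208123392), (35184372088832, 167809024), (140737488355328, 671236096), (144115188075855872, 150995024), (1152921504606846976, 1207960192)]),
  (268435456, [(256, 335544608), (1024, 1342178432), (268435456, 302030848), (2147483648, 2416246784), (70368744177664, 335618048), (281474976710656, 1342472192), (288230376151711744, 301990048), (2305843009213693952, 2415920384)]),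
  (536870912, [(1, 2684354817), (512, 671089216), (536870912, 604061696), (4294967296, 4832493568), (140737488355328, 671236096), (562949953421312, 2684944384), (576460752303423488, 603980096), (4611686018427387904, 4831838721)]),
  (1073741824, [(2, 5368709634), (1024, 1342178432), (4194304, 1079246848), (1073741824, 1208123392), (281474976710656, 1342472192), (1125899906842624, 5369888768), (1152921504606846976, 1207960192), (9223372036854775808, 1077937154)]),
  (2147483648, [(1, 2684354817), (4, 2151678980), (8388608, 2158493696), (2147483648, 2416246784), (562949953421312, 2684944384), (2251799813685248, 2154037248), (2305843009213693952, 2415920384), (18446744073709551616, 2155872261)]),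
  (4294967296, [(2, 5368709634), (8, 4303355913), (16777216, 4312795136), (4294967296, 4832493568), (1125899906842624, 5369888768), (4503599627370496, 4303882240), (4611686018427387904, 4831838721), (36893488147419103232, 4311744522)])]

def findChk (syn : ℕ) (l : List (ℕ × List (ℕ × ℕ))) (k : List (ℕ × ℕ) → Bool) : Bool :=
  List.rec false (fun p _ ih => Bool.rec (k p.2) ih (Nat.beq (Nat.land syn p.1) 0)) l

def allQ (f : ℕ → ℕ → Bool) (l : List (ℕ × ℕ)) : Bool :=
  List.rec true (fun p _ ih => Bool.rec false ih (f p.1 p.2)) l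

def srch1 (syn : ℕ) : Bool := findChk syn tbl
  (allQ fun _ e => Bool.rec true false (Nat.beq syn e))

def srch (r : ℕ) : ℕ → ℕ → Bool :=
  Nat.rec (fun syn _ => srch1 syn)
   (fun _ ih syn used => findChk syn tbl (allQ fun m e =>
      Bool.rec true (ih (Nat.xor syn e) (Nat.lor used m)) (Nat.beq (Nat.land used m) 0))) r


abbrev M66 := ZMod 3 × ZMod 11
abbrev Q66 := M66 ⊕ M66

def bI (a : M66) : ℕ := 11 * a.1.val + a.2.val
def mQ : Q66 → ℕ := Sum.elim (fun b => 2 ^ bI b) (fun b => 2 ^ (33 + bI b))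
def eQ : Q66 → ℕ := Sum.elim
  (fun b => 2 ^ bI b + 2 ^ bI (b - (0, 3)) + 2 ^ bI (b - (1, 2)) + 2 ^ bI (b - (1, 4)))
  (fun b => 2 ^ bI b + 2 ^ bI (b + (0, 3)) + 2 ^ bI (b + (1, 2)) + 2 ^ bI (b + (1, 4)))

theorem srch_run : srch 5 (eQ (Sum.inl 0)) (mQ (Sum.inl 0)) = true := by
  have h1 : eQ (Sum.inl 0) = 2684354817 := by decide +kernel
  have h2 : mQ (Sum.inl 0) = 1 := by decide +kernel
  rw [h1, h2]
  decide +kernel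

theorem tbl_ok : ∀ p ∈ tbl, ∃ i ∈ List.range 33, p.1 = 2 ^ i ∧
    ∀ q : Q66, (eQ q).testBit i = true → (mQ q, eQ q) ∈ p.2 := by decide +kernel

theorem eQ_ok : ∀ (q : Q66) (a : M66),
    bbMat 3 11 c66 a q = if (eQ q).testBit (bI a) = true then 1 else 0 := by decide +kernel

theorem eQ_lt : ∀ q : Q66, eQ q < 2 ^ 33 := by decide +kernel

theorem mQ_ok : ∀ (q q' : Q66), q ≠ q' → Nat.land (mQ q) (mQ q') = 0 := by decide +kernel

theorem bI_surj : ∀ i ∈ List.range 33, ∃ a : M66, bI a = i := by decide +kernel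

theorem findChk_spec (syn : ℕ) (k : List (ℕ × ℕ) → Bool) (l : List (ℕ × List (ℕ × ℕ)))
    (h : findChk syn l k = true) : ∃ p ∈ l, Nat.land syn p.1 ≠ 0 ∧ k p.2 = true := by
  induction l with
  | nil => exact absurd h (by simp [findChk])
  | cons p t ih =>
    have h' : (Bool.rec (k p.2) (findChk syn t k) (Nat.beq (Nat.land syn p.1) 0) : Bool) = true := h
    cases hb : Nat.beq (Nat.land syn p.1) 0 with
    | true =>
      rw [hb] at h'
      obtain ⟨p', hp', h2⟩ := ih h'
      exact ⟨p', List.mem_cons_of_mem _ hp', h2⟩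
    | false =>
      rw [hb] at h'
      exact ⟨p, List.mem_cons_self, Nat.ne_of_beq_eq_false hb, h'⟩

theorem allQ_spec (f : ℕ → ℕ → Bool) (l : List (ℕ × ℕ)) (h : allQ f l = true) :
    ∀ p ∈ l, f p.1 p.2 = true := by
  induction l with
  | nil => simp
  | cons p t ih =>
    have h' : (Bool.rec false (allQ f t) (f p.1 p.2) : Bool) = true := h
    cases hb : f p.1 p.2 with
    | true =>
      rw [hb] at h'
      intro p' hp'
      rcases List.mem_cons.1 hp' with rfl | h2
      · exact hb
      · exact ih h' p' h2
    | false =>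
      rw [hb] at h'
      exact absurd h' (by simp)

def xs (S : Finset Q66) : ℕ := S.fold (· ^^^ ·) 0 eQ

theorem xs_erase (S : Finset Q66) (q : Q66) (h : q ∈ S) : xs S = eQ q ^^^ xs (S.erase q) := by
  conv_lhs => rw [← Finset.insert_erase h]
  exact Finset.fold_insert (Finset.notMem_erase q S)

theorem xs_bit (S : Finset Q66) (i : ℕ) :
    (if (xs S).testBit i = true then (1 : ZMod 2) else 0) =
      ∑ q ∈ S, if (eQ q).testBit i = true then (1 : ZMod 2) else 0 := by
  induction S using Finset.induction_on with
  | empty => simp [xs]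
  | insert q S hq ih =>
    rw [Finset.sum_insert hq, ← ih]
    have : xs (insert q S) = eQ q ^^^ xs S := Finset.fold_insert hq
    rw [this, Nat.testBit_xor]
    cases (eQ q).testBit i <;> cases (xs S).testBit i <;> decide

theorem step (S : Finset Q66) (k : List (ℕ × ℕ) → Bool) (h : findChk (xs S) tbl k = true) :
    ∃ q ∈ S, ∃ l, k l = true ∧ (mQ q, eQ q) ∈ l := by
  obtain ⟨p, hp, h1, h2⟩ := findChk_spec _ _ _ h
  obtain ⟨i, -, hi, hq⟩ := tbl_ok p hp
  have hb : (xs S).testBit i = true := by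
    by_contra hc
    apply h1
    rw [hi]
    change xs S &&& 2 ^ i = 0
    rw [Nat.and_two_pow]
    rw [Bool.not_eq_true] at hc
    rw [hc]
    simp
  have h3 := xs_bit S i
  rw [if_pos hb] at h3
  obtain ⟨q, hqS, hne⟩ := Finset.exists_ne_zero_of_sum_ne_zero (h3 ▸ one_ne_zero)
  refine ⟨q, hqS, p.2, h2, hq q ?_⟩
  by_contra hc
  exact hne (if_neg hc)

theorem srch_sound (r : ℕ) : ∀ (used : ℕ) (S : Finset Q66), srch r (xs S) used = true →
    S.card ≤ r + 1 → (∀ q ∈ S, Nat.land used (mQ q) = 0) → False := by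
  induction r with
  | zero =>
    intro used S h hc _
    obtain ⟨q, hq, l, hl, hm⟩ := step S _ h
    have h1 := allQ_spec _ _ hl _ hm
    have h2 : xs S = eQ q := by
      have : S = {q} := by
        apply (Finset.eq_of_subset_of_card_le (Finset.singleton_subset_iff.2 hq) _).symm
        simpa using hc
      rw [this]
      simp [xs]
    rw [h2] at h1
    simp at h1
  | succ r ih =>
    intro used S h hc hu
    obtain ⟨q, hq, l, hl, hm⟩ := step S _ h
    have h1 := allQ_spec _ _ hl _ hm
    simp only [hu q hq] at h1
    have h1' : srch r (xs S ^^^ eQ q) (used ||| mQ q) = true := h1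
    have h2 : xs S ^^^ eQ q = xs (S.erase q) := by
      rw [xs_erase S q hq, Nat.xor_comm (eQ q), Nat.xor_assoc, Nat.xor_self, Nat.xor_zero]
    rw [h2] at h1'
    refine ih _ _ h1' ?_ ?_
    · rw [Finset.card_erase_of_mem hq]; omega
    · intro q' hq'
      obtain ⟨hne, hq'S⟩ := Finset.mem_erase.1 hq'
      have a1 : used &&& mQ q' = 0 := hu q' hq'S
      have a2 : mQ q &&& mQ q' = 0 := mQ_ok q q' hne.symm
      change (used ||| mQ q) &&& mQ q' = 0
      rw [Nat.and_or_distrib_right, a1, a2]; rfl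

theorem z2 : ∀ z : ZMod 2, z ≠ 0 → z = 1 := by decide

theorem no_low0 (v : Q66 → ZMod 2) (hv : (bbMat 3 11 c66).mulVec v = 0)
    (h0 : v (Sum.inl 0) ≠ 0) (hw : hammingNorm v ≤ 7) : False := by
  let S : Finset Q66 := Finset.univ.filter fun q => v q ≠ 0
  have hS : S.card ≤ 7 := hw
  have hsum : ∀ a, ∑ q ∈ S, bbMat 3 11 c66 a q = 0 := by
    intro a
    have := congrFun hv a
    simp only [Matrix.mulVec, dotProduct, Pi.zero_apply] at this
    rw [← this, Finset.sum_filter]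
    apply Finset.sum_congr rfl
    intro q _
    by_cases hq : v q = 0
    · simp [hq]
    · simp [z2 _ hq]
  have hx : xs S = 0 := by
    apply Nat.eq_of_testBit_eq
    intro i
    rw [Nat.zero_testBit]
    have h3 := xs_bit S i
    have h4 : ∑ q ∈ S, (if (eQ q).testBit i = true then (1 : ZMod 2) else 0) = 0 := by
      by_cases hi : i < 33
      · obtain ⟨a, rfl⟩ := bI_surj i (List.mem_range.2 hi)
        exact (Finset.sum_congr rfl fun q _ => (eQ_ok q a).symm).trans (hsum a)
      · apply Finset.sum_eq_zero
        intro q _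
        rw [Nat.testBit_lt_two_pow (lt_of_lt_of_le (eQ_lt q) (Nat.pow_le_pow_right (by norm_num) (by omega)))]
        rfl
    rw [h4] at h3
    by_contra hc
    rw [if_pos (by simpa using hc)] at h3
    exact one_ne_zero h3
  have hq : (Sum.inl 0 : Q66) ∈ S := by simp [S, h0]
  rw [xs_erase S _ hq, Nat.xor_eq_zero_iff] at hx
  have hr := srch_run
  rw [hx] at hr
  refine srch_sound 5 _ _ hr ?_ ?_
  · rw [Finset.card_erase_of_mem hq]; omega
  · intro q' hq'
    exact mQ_ok _ _ (Finset.mem_erase.1 hq').1.symm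

theorem mv (v : Q66 → ZMod 2) (a : M66) : (bbMat 3 11 c66).mulVec v a =
    (∑ b, c66 (b - a) * v (Sum.inl b)) + ∑ b, c66 (a - b) * v (Sum.inr b) := by
  simp [Matrix.mulVec, dotProduct, Fintype.sum_sum_type, bbMat]

theorem hn (v w : Q66 → ZMod 2) (e : Q66 ≃ Q66) (h : ∀ q, w q = v (e q)) :
    hammingNorm w = hammingNorm v := by
  unfold hammingNorm
  apply Finset.card_bij (fun q _ => e q)
  · intro q hq; simpa [h] using hq
  · intro a _ b _ hab; exact e.injective hab
  · intro b hb; exact ⟨e.symm b, by simpa [h] using hb, by simp⟩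

theorem shift_ker (v : Q66 → ZMod 2) (hv : (bbMat 3 11 c66).mulVec v = 0) (g a : M66) :
    (∑ b, c66 (b - a) * v (Sum.inl (b + g))) + ∑ b, c66 (a - b) * v (Sum.inr (b + g)) = 0 := by
  have h := congrFun hv (a + g)
  rw [mv, Pi.zero_apply] at h
  refine Eq.trans (congrArg₂ (· + ·) ?_ ?_) h
  · exact Fintype.sum_equiv (Equiv.addRight g) _ _
      (fun b => by rw [Equiv.coe_addRight, add_sub_add_right_eq_sub])
  · exact Fintype.sum_equiv (Equiv.addRight g) _ _
      (fun b => by rw [Equiv.coe_addRight, add_sub_add_right_eq_sub])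

theorem swap_ker (v : Q66 → ZMod 2) (hv : (bbMat 3 11 c66).mulVec v = 0) (g a : M66) :
    (∑ b, c66 (b - a) * v (Sum.inr (g - b))) + ∑ b, c66 (a - b) * v (Sum.inl (g - b)) = 0 := by
  have h := congrFun hv (g - a)
  rw [mv, Pi.zero_apply, add_comm] at h
  refine Eq.trans (congrArg₂ (· + ·) ?_ ?_) h
  · exact Fintype.sum_equiv (Equiv.subLeft g) _ _
      (fun b => by rw [Equiv.subLeft_apply, sub_sub_sub_cancel_left])
  · exact Fintype.sum_equiv (Equiv.subLeft g) _ _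
      (fun b => by rw [Equiv.subLeft_apply, sub_sub_sub_cancel_left])

theorem no_low (v : Q66 → ZMod 2) (hv : (bbMat 3 11 c66).mulVec v = 0)
    (h0 : v ≠ 0) (hw : hammingNorm v ≤ 7) : False := by
  obtain ⟨q, hq⟩ := Function.ne_iff.1 h0
  rw [Pi.zero_apply] at hq
  rcases q with g | g
  · refine no_low0 (fun q => v (Equiv.sumCongr (Equiv.addRight g) (Equiv.addRight g) q)) ?_ ?_
      ((hn v _ _ fun _ => rfl).trans_le hw)
    · funext a
      rw [mv]
      exact shift_ker v hv g a
    · change v (Sum.inl (0 + g)) ≠ 0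
      rwa [zero_add]
  · refine no_low0 (fun q => v (((Equiv.sumComm _ _).trans
      (Equiv.sumCongr (Equiv.subLeft g) (Equiv.subLeft g))) q)) ?_ ?_
      ((hn v _ _ fun _ => rfl).trans_le hw)
    · funext a
      rw [mv]
      exact swap_ker v hv g a
    · change v (Sum.inr (g - 0)) ≠ 0
      rwa [sub_zero]

/-- weight 8 logical operator -/
def wit : Q66 → ZMod 2 := fun q => if
  mQ q ∈ [2 ^ 0, 2 ^ 6, 2 ^ 13, 2 ^ 23, 2 ^ 42, 2 ^ 52, 2 ^ 59, 2 ^ 65] then 1 else 0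

theorem wit_ker : (bbMat 3 11 c66).mulVec wit = 0 := by
  funext a
  rw [mv, Pi.zero_apply]
  revert a
  decide +kernel

theorem wit_norm : hammingNorm wit = 8 := by decide +kernel

theorem c_sum : ∀ (a : M66) (x : ZMod 3), ∑ y : ZMod 11, c66 ((x, y) - a) = 0 := by decide +kernel

theorem wit_not : ¬ ∃ u, Matrix.vecMul u (bbMat 3 11 c66) = wit := by
  rintro ⟨u, hu⟩
  have h1 : ∑ y : ZMod 11, wit (Sum.inl (1, y)) = 1 := by decide +kernel
  have h2 : ∑ y : ZMod 11, wit (Sum.inl (1, y)) = 0 := by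
    rw [← hu]
    simp only [Matrix.vecMul, dotProduct]
    rw [Finset.sum_comm]
    apply Finset.sum_eq_zero
    intro a _
    rw [← Finset.mul_sum]
    simp only [bbMat, Matrix.of_apply, Sum.elim_inl]
    rw [c_sum, mul_zero]
  rw [h1] at h2
  exact one_ne_zero h2

def Qm : Matrix (ZMod 3) M66 (ZMod 2) := Matrix.of fun x a => if a.1 = x then 1 else 0
def Pm : Matrix M66 (ZMod 3) (ZMod 2) := Matrix.of fun a x => if a.1 = x then 1 else 0

def sG : M66 → ZMod 2 := fun a => if
  bI a ∈ [0, 5, 6, 7, 8, 9, 12, 15, 16, 17, 18, 19, 22, 23, 25, 27, 28, 30] then 1 else 0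

def Gm : Matrix Q66 M66 (ZMod 2) := Matrix.of fun q b => Sum.elim (fun d => sG (d - b)) (fun _ => 0) q

theorem QP : Qm * Pm = 1 := by
  ext x y
  rw [Matrix.mul_apply, Matrix.one_apply]
  revert x y
  decide +kernel

theorem QH : Qm * bbMat 3 11 c66 = 0 := by
  ext x q
  rw [Matrix.mul_apply, Matrix.zero_apply]
  revert x q
  decide +kernel

theorem sG_ok : ∀ g : M66, (if g = 0 then (1 : ZMod 2) else 0) =
    ∑ d, c66 (d - g) * sG d + if g.1 = 0 then 1 else 0 := by decide +kernel

theorem HG1 (a b : M66) : (bbMat 3 11 c66 * Gm) a b = ∑ d, c66 (d - (a - b)) * sG d := by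
  have h : ∑ d, c66 (d - (a - b)) * sG d = ∑ d, c66 (d - a) * sG (d - b) :=
      Fintype.sum_equiv (Equiv.addRight b) _ _ (fun d => by
        rw [Equiv.coe_addRight, add_sub_cancel_right, sub_sub_eq_add_sub])
  rw [h, Matrix.mul_apply, Fintype.sum_sum_type]
  have h2 : ∑ d : M66, bbMat 3 11 c66 a (Sum.inr d) * Gm (Sum.inr d) b = 0 :=
    Finset.sum_eq_zero fun d _ => mul_zero _
  rw [h2, add_zero]
  rfl

theorem PQ : ∀ (x y : ZMod 3), (∑ j : ZMod 3, (if x = j then (1 : ZMod 2) else 0) *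
    (if y = j then (1 : ZMod 2) else 0)) = if x - y = 0 then 1 else 0 := by decide +kernel

theorem HG2 (a b : M66) : (Pm * Qm) a b = if (a - b).1 = 0 then 1 else 0 := by
  rw [Matrix.mul_apply]
  exact PQ a.1 b.1

theorem HG : (1 : Matrix M66 M66 (ZMod 2)) = bbMat 3 11 c66 * Gm + Pm * Qm := by
  apply Matrix.ext
  intro a b
  rw [Matrix.add_apply, HG1, HG2, Matrix.one_apply]
  refine Eq.trans ?_ (sG_ok (a - b))
  by_cases hab : a = b
  · rw [if_pos hab, if_pos (sub_eq_zero.2 hab)]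
  · rw [if_neg hab, if_neg (fun h => hab (sub_eq_zero.1 h))]

theorem rank_add_le' (A B : Matrix M66 M66 (ZMod 2)) : (A + B).rank ≤ A.rank + B.rank := by
  unfold Matrix.rank
  rw [Matrix.mulVecLin_add]
  exact (Submodule.finrank_mono (LinearMap.range_add_le _ _)).trans
    (Submodule.finrank_add_le_finrank_add_finrank _ _)

theorem cardM : Fintype.card M66 = 33 := by simp [ZMod.card]


theorem rankH : (bbMat 3 11 c66).rank = 30 := by
  apply le_antisymm
  · have h1 := Matrix.rank_add_rank_le_card_of_mul_eq_zero QH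
    have h2 : 3 ≤ Qm.rank := by
      have := Matrix.rank_mul_le_left Qm Pm
      rw [QP, Matrix.rank_one, ZMod.card] at this
      exact this
    rw [cardM] at h1
    omega
  · have h1 := rank_add_le' (bbMat 3 11 c66 * Gm) (Pm * Qm)
    rw [← HG, Matrix.rank_one, cardM] at h1
    have h2 := Matrix.rank_mul_le_left (bbMat 3 11 c66) Gm
    have h3 := (Matrix.rank_mul_le_left Pm Qm).trans (Matrix.rank_le_card_width Pm)
    rw [ZMod.card] at h3
    omega

/-- **`BB(1 + y³ + x y² + x y⁴, ·ᵀ; R_{3,11})` is a `[[66, 6, 8]]` code.**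
The check matrix `H ∈ F₂^{33×66}` has rank 30 (so the code encodes
`k = 66 - 2·30 = 6` logical qubits), and the minimum Hamming weight of a vector
`v ∈ F₂^{66}` with `H v = 0` not in the row space of `H` equals 8. -/
theorem stmt_13 :
    (bbMat 3 11 c66).rank = 30 ∧
    sInf {w | ∃ v : ((ZMod 3 × ZMod 11) ⊕ (ZMod 3 × ZMod 11)) → ZMod 2,
        (bbMat 3 11 c66).mulVec v = 0 ∧
        (¬ ∃ u, Matrix.vecMul u (bbMat 3 11 c66) = v) ∧ hammingNorm v = w} = 8 := by
  have hm : 8 ∈ {w | ∃ v : ((ZMod 3 × ZMod 11) ⊕ (ZMod 3 × ZMod 11)) → ZMod 2,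
        (bbMat 3 11 c66).mulVec v = 0 ∧
        (¬ ∃ u, Matrix.vecMul u (bbMat 3 11 c66) = v) ∧ hammingNorm v = w} :=
    ⟨wit, wit_ker, wit_not, wit_norm⟩
  refine ⟨rankH, le_antisymm (Nat.sInf_le hm) ?_⟩
  apply le_csInf ⟨8, hm⟩
  rintro w ⟨v, hv, hn, rfl⟩
  by_contra hc
  refine no_low v hv ?_ (by omega)
  rintro rfl
  exact hn ⟨0, by simp⟩
end
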